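/- For every u ∈ V, e_u ∈ D(S_λ) and ‖S_λ e_u‖ = 2^{Σ_{n ≤ M(u)} u(n)} · γ (the exponent being a finite sum); consequently S_λ is densely defined and injective, with c(u) = 2^{Σ_{n ≤ M(u)} u(n)} · γ > 0 for every u ∈ V. -/

import Mathlib

open scoped ENNReal NNReal ComplexConjugate Classical ComplexInnerProductSpace

noncomputable section

/-- `HS V` is the Hilbert space `ℓ²(V)` of square-summable families of complex numbers
indexed by `V`. -/
abbrev HS (V : Type*) : Type _ := lp (fun _ : V => ℂ) 2

/-- A (possibly unbounded) partially defined operator in a Hilbert space `E`: a domain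
together with an assignment of values.  Only the restriction of `toFun` to `dom` is
relevant (e.g. via `POp.graph`). -/
structure POp (E : Type*) [NormedAddCommGroup E] [InnerProductSpace ℂ E] where
  dom : Set E
  toFun : E → E

namespace POp

variable {E : Type*} [NormedAddCommGroup E] [InnerProductSpace ℂ E]

/-- Composition of partially defined operators: `(A.comp B) f = A (B f)` on the natural
domain `{f ∈ dom B : B f ∈ dom A}`. -/
def comp (A B : POp E) : POp E :=
  ⟨{f | f ∈ B.dom ∧ B.toFun f ∈ A.dom}, fun f => A.toFun (B.toFun f)⟩

/-- The graph of a partially defined operator, as a subset of `E × E`. -/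
def graph (A : POp E) : Set (E × E) := {p | p.1 ∈ A.dom ∧ p.2 = A.toFun p.1}

/-- The Hilbert-space adjoint of a (densely defined) partially defined operator `A`:
`g ∈ dom A*` iff there is `h` with `⟪A f, g⟫ = ⟪f, h⟫` for all `f ∈ dom A`, and then
`A* g = h` (`h` is unique when `A` is densely defined). -/
def adj (A : POp E) : POp E :=
  ⟨{g | ∃ h : E, ∀ f ∈ A.dom, ⟪A.toFun f, g⟫ = ⟪f, h⟫},
   fun g => if h : ∃ h' : E, ∀ f ∈ A.dom, ⟪A.toFun f, g⟫ = ⟪f, h'⟫ then h.choose else 0⟩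

end POp

variable {V : Type*}

/-- The element of `ℓ²(V)` with coordinates `g` (junk value `0` if `g` is not
square-summable). -/
def mkH (g : V → ℂ) : HS V := if h : Memℓp g 2 then ⟨g, h⟩ else 0

/-- The standard orthonormal basis vector `e_u` of `ℓ²(V)`. -/
def eV (u : V) : HS V := mkH (fun v => if v = u then 1 else 0)

/-- The weighted shift `S_λ` on the directed tree encoded by the parent map `par`
(with `Chi(u) = {v : par v = u}`), with weights `lam`:
domain `{f : Σ_u (Σ_{v ∈ Chi(u)} |λ v|²)·|f u|² < ∞}` and value
`(S_λ f)(v) = λ v · f (par v)`. -/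
def shiftOp (par : V → V) (lam : V → ℂ) : POp (HS V) :=
  ⟨{f | ∑' u : V, ((∑' v : {v : V // par v = u}, ((‖lam v.1‖₊ : ℝ≥0∞) ^ 2)) *
        (‖f u‖₊ : ℝ≥0∞) ^ 2) < ⊤},
   fun f => mkH (fun v => lam v * f (par v))⟩

/-- `cW par lam u = (Σ_{v ∈ Chi(u)} |λ v|²)^{1/2}`, i.e. `c(u) = ‖S_λ e_u‖`. -/
def cW (par : V → V) (lam : V → ℂ) (u : V) : ℝ :=
  Real.sqrt (∑' v : {v : V // par v = u}, ‖lam v.1‖ ^ 2)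

/-- The defining property of a vertex of the directed tree of Section 6: there is `M ∈ ℤ`
with `g n ≥ 0` for `n ≤ M`, `g n = -1` for `n > M`, and `g n = 0` for all sufficiently
small `n`.  Such an `M` is unique. -/
def Cond (g : ℤ → ℤ) : Prop :=
  ∃ M : ℤ, (∀ n ≤ M, 0 ≤ g n) ∧ (∀ n, M < n → g n = -1) ∧ ∃ N : ℤ, ∀ n < N, g n = 0

/-- The vertex set `V` of the directed tree of Section 6. -/
def VT : Type := {g : ℤ → ℤ // Cond g}

/-- `Mv v = M(v)`, the largest index at which `v` differs from `-1`. -/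
def Mv (v : VT) : ℤ := v.2.choose

theorem Mv_spec (v : VT) :
    (∀ n ≤ Mv v, 0 ≤ v.1 n) ∧ (∀ n, Mv v < n → v.1 n = -1) ∧ ∃ N : ℤ, ∀ n < N, v.1 n = 0 :=
  v.2.choose_spec

/-- The parent map of the tree of Section 6: `par v` agrees with `v` except at `M(v)`,
where it takes the value `-1` (so that `M(par v) = M(v) - 1`). -/
def parT (v : VT) : VT :=
  ⟨fun n => if n = Mv v then -1 else v.1 n, by
    obtain ⟨h1, h2, N, h3⟩ := Mv_spec v
    refine ⟨Mv v - 1, fun n hn => ?_, fun n hn => ?_, min N (Mv v), fun n hn => ?_⟩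
    · dsimp only; rw [if_neg (by omega)]; exact h1 n (by omega)
    · dsimp only
      by_cases h : n = Mv v
      · rw [if_pos h]
      · rw [if_neg h]; exact h2 n (by omega)
    · have h' := lt_min_iff.mp hn
      dsimp only; rw [if_neg (by omega)]; exact h3 n (by omega)⟩

/-- The weights of Section 6: `λ v = 2^{Σ_{n < M(v)} v(n)} / (v(M(v)) + 1)`
(the sum has finitely many nonzero terms). -/
def lamT (v : VT) : ℂ :=
  (((2 : ℝ) ^ (∑ᶠ n ∈ Set.Iio (Mv v), v.1 n) / ((v.1 (Mv v) : ℝ) + 1)) : ℂ)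

/-- `γ = (Σ_{n=1}^∞ n^{-2})^{1/2}`. -/
def gam : ℝ := Real.sqrt (∑' n : ℕ, (1 : ℝ) / ((n : ℝ) + 1) ^ 2)

theorem Mv_eq {v : VT} {M : ℤ} (h0 : 0 ≤ v.1 M) (h1 : v.1 (M + 1) = -1) : Mv v = M := by
  obtain ⟨a, b, -⟩ := Mv_spec v
  have h2 : M ≤ Mv v := by
    by_contra h
    have := b M (by omega)
    omega
  have h3 : Mv v < M + 1 := by
    by_contra h
    have := a (M + 1) (by omega)
    omega
  omega

theorem Mv_parT (v : VT) : Mv (parT v) = Mv v - 1 := by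
  obtain ⟨a, -, -⟩ := Mv_spec v
  refine Mv_eq ?_ ?_
  · change 0 ≤ if Mv v - 1 = Mv v then -1 else v.1 (Mv v - 1)
    rw [if_neg (by omega)]
    exact a _ (by omega)
  · change (if Mv v - 1 + 1 = Mv v then -1 else v.1 (Mv v - 1 + 1)) = -1
    rw [if_pos (by omega)]

/-- The child of `u` whose last entry, at `M(u) + 1`, is `k`. -/
def childT (u : VT) (k : ℕ) : VT :=
  ⟨fun n => if n = Mv u + 1 then (k : ℤ) else u.1 n, by
    obtain ⟨h1, h2, N, h3⟩ := Mv_spec u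
    refine ⟨Mv u + 1, fun n hn => ?_, fun n hn => ?_, min N (Mv u), fun n hn => ?_⟩
    · dsimp only
      split_ifs with h
      · positivity
      · exact h1 n (by omega)
    · dsimp only
      rw [if_neg (by omega)]
      exact h2 n (by omega)
    · have h' := lt_min_iff.mp hn
      dsimp only
      rw [if_neg (by omega)]
      exact h3 n (by omega)⟩

theorem childT_apply (u : VT) (k : ℕ) (n : ℤ) :
    (childT u k).1 n = if n = Mv u + 1 then (k : ℤ) else u.1 n := rfl

theorem parT_apply (v : VT) (n : ℤ) :
    (parT v).1 n = if n = Mv v then -1 else v.1 n := rfl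

theorem Mv_childT (u : VT) (k : ℕ) : Mv (childT u k) = Mv u + 1 := by
  refine Mv_eq ?_ ?_
  · simp [childT_apply]
  · rw [childT_apply, if_neg (by omega)]
    exact (Mv_spec u).2.1 _ (by omega)

theorem parT_childT (u : VT) (k : ℕ) : parT (childT u k) = u := by
  refine Subtype.ext (funext fun n => ?_)
  rw [parT_apply, Mv_childT, childT_apply]
  split_ifs with h
  · rw [(Mv_spec u).2.1 n (by omega)]
  · rfl

theorem childT_parT (v : VT) : childT (parT v) (v.1 (Mv v)).toNat = v := by
  refine Subtype.ext (funext fun n => ?_)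
  rw [childT_apply, Mv_parT, parT_apply, Int.toNat_of_nonneg ((Mv_spec v).1 _ le_rfl)]
  rw [sub_add_cancel]
  split_ifs with h
  · rw [h]
  · rfl

/-- The children of `u` are parametrized by their last entry. -/
def childEquiv (u : VT) : ℕ ≃ {v : VT // parT v = u} where
  toFun k := ⟨childT u k, parT_childT u k⟩
  invFun v := (v.1.1 (Mv v.1)).toNat
  left_inv k := by simp [Mv_childT, childT_apply]
  right_inv := by
    rintro ⟨v, rfl⟩
    exact Subtype.ext (childT_parT v)

theorem norm_lamT (v : VT) :
    ‖lamT v‖ = (2 : ℝ) ^ (∑ᶠ n ∈ Set.Iio (Mv v), v.1 n) / ((v.1 (Mv v) : ℝ) + 1) := by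
  have h : (0 : ℝ) ≤ (v.1 (Mv v) : ℝ) := by exact_mod_cast (Mv_spec v).1 _ le_rfl
  have hl : lamT v =
      (((2 : ℝ) ^ (∑ᶠ n ∈ Set.Iio (Mv v), v.1 n) / ((v.1 (Mv v) : ℝ) + 1) : ℝ) : ℂ) := by
    simp [lamT]
  rw [hl, Complex.norm_real, Real.norm_of_nonneg (by positivity)]

theorem lamT_ne_zero (v : VT) : lamT v ≠ 0 := by
  have h : (0 : ℝ) ≤ (v.1 (Mv v) : ℝ) := by exact_mod_cast (Mv_spec v).1 _ le_rfl
  rw [← norm_pos_iff, norm_lamT]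
  positivity

theorem norm_lamT_childT (u : VT) (k : ℕ) :
    ‖lamT (childT u k)‖ = (2 : ℝ) ^ (∑ᶠ n ∈ Set.Iic (Mv u), u.1 n) / ((k : ℝ) + 1) := by
  have hs : ∑ᶠ n ∈ Set.Iio (Mv u + 1), (childT u k).1 n = ∑ᶠ n ∈ Set.Iic (Mv u), u.1 n := by
    refine finsum_mem_congr (Set.ext fun n => by simp) fun n hn => ?_
    have hn' : n ≤ Mv u := hn
    rw [childT_apply, if_neg (by omega)]
  rw [norm_lamT, Mv_childT, hs, childT_apply, if_pos rfl]
  simp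

theorem summable_one_div_add_one_sq : Summable fun n : ℕ => (1 : ℝ) / ((n : ℝ) + 1) ^ 2 := by
  simpa using (summable_nat_add_iff 1).2 (Real.summable_one_div_nat_pow.2 one_lt_two)

theorem gam_sq : gam ^ 2 = ∑' n : ℕ, (1 : ℝ) / ((n : ℝ) + 1) ^ 2 :=
  Real.sq_sqrt (tsum_nonneg fun n => by positivity)

theorem gam_pos : 0 < gam :=
  Real.sqrt_pos.2 (summable_one_div_add_one_sq.tsum_pos (fun n => by positivity) 0 (by simp))

theorem hasSum_norm_lamT_sq (u : VT) :
    HasSum (fun v : {v : VT // parT v = u} => ‖lamT v.1‖ ^ 2)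
      (((2 : ℝ) ^ (∑ᶠ n ∈ Set.Iic (Mv u), u.1 n) * gam) ^ 2) := by
  rw [← (childEquiv u).hasSum_iff, mul_pow, gam_sq]
  have h : (fun v : {v : VT // parT v = u} => ‖lamT v.1‖ ^ 2) ∘ childEquiv u = fun k : ℕ =>
      ((2 : ℝ) ^ (∑ᶠ n ∈ Set.Iic (Mv u), u.1 n)) ^ 2 * (1 / ((k : ℝ) + 1) ^ 2) := by
    funext k
    change ‖lamT (childT u k)‖ ^ 2 = _
    rw [norm_lamT_childT, div_pow, mul_one_div]
  rw [h]
  exact summable_one_div_add_one_sq.hasSum.mul_left _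

theorem cW_eq (u : VT) :
    cW parT lamT u = (2 : ℝ) ^ (∑ᶠ n ∈ Set.Iic (Mv u), u.1 n) * gam := by
  rw [cW, (hasSum_norm_lamT_sq u).tsum_eq,
    Real.sqrt_sq (mul_nonneg (by positivity) gam_pos.le)]

theorem mkH_apply {g : V → ℂ} (h : Memℓp g 2) (v : V) : mkH g v = g v := by
  rw [mkH, dif_pos h]

theorem memℓp_two_iff {g : V → ℂ} : Memℓp g 2 ↔ Summable fun v => ‖g v‖ ^ 2 := by
  rw [memℓp_gen_iff (by norm_num)]
  simp

theorem norm_mkH_sq {g : V → ℂ} (h : Memℓp g 2) : ‖mkH g‖ ^ 2 = ∑' v, ‖g v‖ ^ 2 := by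
  have := lp.norm_rpow_eq_tsum (p := 2) (by norm_num) (mkH g)
  simpa [mkH_apply h] using this

theorem eV_eq_single (u : V) : eV u = lp.single 2 u (1 : ℂ) := by
  have h : (fun v : V => if v = u then (1 : ℂ) else 0) = lp.single 2 u (1 : ℂ) := by
    ext v
    simp [lp.single_apply, Pi.single_apply]
  refine lp.ext (funext fun v => ?_)
  rw [eV, mkH_apply (h ▸ lp.memℓp _), ← h]

theorem eV_apply (u v : V) : eV u v = if v = u then 1 else 0 := by
  rw [eV_eq_single]
  simp [lp.single_apply, Pi.single_apply]

theorem memℓp_of_mem_dom {par : V → V} {lam : V → ℂ} {f : HS V}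
    (hf : f ∈ (shiftOp par lam).dom) : Memℓp (fun v => lam v * f (par v)) 2 := by
  have h : ∑' v, (‖lam v * f (par v)‖₊ : ℝ≥0∞) ^ 2 < ⊤ := by
    refine lt_of_eq_of_lt ?_ hf
    rw [← (Equiv.sigmaFiberEquiv par).tsum_eq, ENNReal.tsum_sigma']
    refine tsum_congr fun u => ?_
    rw [← ENNReal.tsum_mul_right]
    refine tsum_congr ?_
    rintro ⟨v, rfl⟩
    simp [nnnorm_mul, mul_pow]
  rw [memℓp_two_iff]
  have h' : Summable fun v => ‖lam v * f (par v)‖₊ ^ 2 := by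
    rw [← ENNReal.tsum_coe_ne_top_iff_summable]
    simpa using h.ne
  simpa using NNReal.summable_coe.2 h'

/-- Finitely supported vectors lie in the domain of a weighted shift as soon as every vertex has
square-summable weights on its children. -/
theorem mem_dom_of_finite_support {par : V → V} {lam : V → ℂ}
    (hc : ∀ u, Summable fun v : {v : V // par v = u} => ‖lam v.1‖ ^ 2) {f : HS V} (s : Finset V)
    (hs : ∀ u ∉ s, f u = 0) : f ∈ (shiftOp par lam).dom := by
  rw [shiftOp, Set.mem_ofPred_eq, tsum_eq_sum (s := s) fun u hu => by simp [hs u hu]]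
  refine ENNReal.sum_lt_top.2 fun u _ => ENNReal.mul_lt_top ?_ (by finiteness)
  have h : Summable fun v : {v : V // par v = u} => ‖lam v.1‖₊ ^ 2 :=
    NNReal.summable_coe.1 (by simpa using hc u)
  simpa using (ENNReal.tsum_coe_ne_top_iff_summable.2 h).lt_top

theorem eV_mem_dom {par : V → V} {lam : V → ℂ}
    (hc : ∀ u, Summable fun v : {v : V // par v = u} => ‖lam v.1‖ ^ 2) (u : V) :
    eV u ∈ (shiftOp par lam).dom :=
  mem_dom_of_finite_support hc {u} fun v hv => by
    rw [eV_apply, if_neg (by simpa using hv)]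

theorem dense_dom {par : V → V} {lam : V → ℂ}
    (hc : ∀ u, Summable fun v : {v : V // par v = u} => ‖lam v.1‖ ^ 2) :
    Dense (shiftOp par lam).dom := fun f => by
  refine mem_closure_of_tendsto (lp.hasSum_single (by norm_num) f)
    (Filter.Eventually.of_forall fun s => mem_dom_of_finite_support hc s fun u hu => ?_)
  rw [lp.coeFn_sum, Finset.sum_apply]
  refine Finset.sum_eq_zero fun v hv => ?_
  rw [lp.single_apply, Pi.single_eq_of_ne]
  rintro rfl
  exact hu hv

theorem norm_shiftOp_eV {par : V → V} {lam : V → ℂ}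
    (hc : ∀ u, Summable fun v : {v : V // par v = u} => ‖lam v.1‖ ^ 2) (u : V) :
    ‖(shiftOp par lam).toFun (eV u)‖ = cW par lam u := by
  rw [cW, eq_comm, Real.sqrt_eq_iff_eq_sq (tsum_nonneg fun _ => by positivity) (norm_nonneg _),
    shiftOp, norm_mkH_sq (memℓp_of_mem_dom (eV_mem_dom hc u))]
  refine (tsum_subtype {v | par v = u} fun v => ‖lam v‖ ^ 2).trans (tsum_congr fun v => ?_)
  by_cases h : par v = u <;> simp [eV_apply, h]

theorem injOn_shiftOp {par : V → V} {lam : V → ℂ} (hpar : Function.Surjective par)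
    (hlam : ∀ v, lam v ≠ 0) : Set.InjOn (shiftOp par lam).toFun (shiftOp par lam).dom := by
  intro f hf g hg hfg
  refine lp.ext (funext fun u => ?_)
  obtain ⟨v, rfl⟩ := hpar u
  have h := congrArg (fun F : HS V => F v) hfg
  simp only [shiftOp, mkH_apply (memℓp_of_mem_dom hf), mkH_apply (memℓp_of_mem_dom hg)] at h
  exact mul_left_cancel₀ (hlam v) h

/-- Proposition 6.1: on the tree of Section 6, every `e_u` lies in
`D(S_λ)` with `‖S_λ e_u‖ = 2^{Σ_{n ≤ M(u)} u(n)}·γ`; consequently `S_λ` is densely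
defined and injective, and `c(u) = 2^{Σ_{n ≤ M(u)} u(n)}·γ > 0` for every `u`. -/
theorem statement_10 :
    (∀ u : VT, eV u ∈ (shiftOp parT lamT).dom ∧
      ‖(shiftOp parT lamT).toFun (eV u)‖ = (2 : ℝ) ^ (∑ᶠ n ∈ Set.Iic (Mv u), u.1 n) * gam) ∧
    Dense (shiftOp parT lamT).dom ∧
    Set.InjOn (shiftOp parT lamT).toFun (shiftOp parT lamT).dom ∧
    (∀ u : VT, cW parT lamT u = (2 : ℝ) ^ (∑ᶠ n ∈ Set.Iic (Mv u), u.1 n) * gam ∧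
      0 < cW parT lamT u) := by
  have hc (u : VT) := (hasSum_norm_lamT_sq u).summable
  refine ⟨fun u => ⟨eV_mem_dom hc u, ?_⟩, dense_dom hc,
    injOn_shiftOp (fun u => ⟨childT u 0, parT_childT u 0⟩) lamT_ne_zero, fun u => ⟨cW_eq u, ?_⟩⟩
  · rw [norm_shiftOp_eV hc, cW_eq]
  · rw [cW_eq]
    exact mul_pos (by positivity) gam_pos
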